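/- Let k ≥ 2 be an integer and define the piecewise-linear map T_k : ℝ² → ℝ² by T_k(x₀,x₁) = (x₁ + k·max(0,x₀), −x₀). If (x₀,x₁) satisfies x₀ > 0 and x₀ + x₁ > 0, then for every m ≥ 0 the iterate T_k^m(x₀,x₁) again satisfies these two inequalities, and T_k^m(x₀,x₁) = M^m(x₀,x₁), where M : ℝ² → ℝ² is the linear map with matrix [[k,1],[−1,0]]. -/

import Mathlib

/-- The tropicalized action of the generator of `Γ_{L_k}` on the tropical X-space:
`T_k(x₀,x₁) = (x₁ + k·max(0,x₀), −x₀)`. -/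
def TLk (k : ℕ) : ℝ × ℝ → ℝ × ℝ :=
  fun p => (p.2 + (k : ℝ) * max 0 p.1, -p.1)

/-- The linear map with matrix `[[k,1],[−1,0]]`. -/
def MLk (k : ℕ) : ℝ × ℝ → ℝ × ℝ :=
  fun p => ((k : ℝ) * p.1 + p.2, -p.1)

theorem TLk_eq_MLk (k : ℕ) {p : ℝ × ℝ} (h₀ : 0 ≤ p.1) : TLk k p = MLk k p := by
  simp only [TLk, MLk, max_eq_right h₀, add_comm]

theorem MLk_mem_cone {k : ℕ} (hk : 2 ≤ k) {p : ℝ × ℝ} (h₀ : 0 < p.1) (h₁ : 0 < p.1 + p.2) :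
    0 < (MLk k p).1 ∧ 0 < (MLk k p).1 + (MLk k p).2 := by
  have hk' : (2 : ℝ) ≤ k := by exact_mod_cast hk
  have h : 2 * p.1 ≤ k * p.1 := mul_le_mul_of_nonneg_right hk' h₀.le
  constructor <;> simp only [MLk] <;> linarith

/-- On the cone `{x₀ > 0, x₀ + x₁ > 0}`, the piecewise-linear map `T_k` preserves
the cone and coincides with the linear map `M = [[k,1],[−1,0]]` on all iterates. -/
theorem TLk_cone_invariant_and_linear (k : ℕ) (hk : 2 ≤ k) (p : ℝ × ℝ)
    (h₀ : 0 < p.1) (h₁ : 0 < p.1 + p.2) :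
    ∀ m : ℕ, (0 < ((TLk k)^[m] p).1 ∧ 0 < ((TLk k)^[m] p).1 + ((TLk k)^[m] p).2) ∧
      (TLk k)^[m] p = (MLk k)^[m] p := by
  intro m
  induction m with
  | zero => exact ⟨⟨h₀, h₁⟩, rfl⟩
  | succ m ih =>
    obtain ⟨⟨ih₀, ih₁⟩, ih_eq⟩ := ih
    rw [Function.iterate_succ_apply', Function.iterate_succ_apply', TLk_eq_MLk k ih₀.le]
    exact ⟨MLk_mem_cone hk ih₀ ih₁, congrArg (MLk k) ih_eq⟩
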